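/- Let L = [l_{ij}] be a real symmetric N×N Laplacian (zero row sums), Z = diag(z_1, …, z_N) with z_i > 0, H an n×n real matrix with symmetric part H⁽ˢ⁾, f : ℝ^n → ℝ^n satisfying the QUAD condition with symmetric positive semidefinite matrix F, G : ℝ^n → ℝ^{n×m}, γ_1, …, γ_N ∈ ℝ^m constant, and k_i > 0. Let s : ℝ → ℝ^n satisfy ṡ(t) = f(s(t)), and let x_i : ℝ → ℝ^n and γ̂_i : ℝ → ℝ^m be differentiable and satisfy the closed-loop equations ẋ_i(t) = f(x_i(t)) + G(x_i(t))γ_i − Σ_{j=1}^N l_{ij} H x_j(t) − z_i H (x_i(t) − s(t)) − G(x_i(t)) γ̂_i(t) and γ̂̇_i(t) = k_i G(x_i(t))ᵀ (x_i(t) − s(t)). Set e_i = x_i − s, γ̃_i = γ_i − γ̂_i, and V(t) = (1/2)Σ_{i=1}^N ‖e_i(t)‖² + Σ_{i=1}^N (1/(2k_i))‖γ̃_i(t)‖². Then for all t, V̇(t) ≤ e(t)ᵀ (I_N ⊗ F − (L + Z) ⊗ H⁽ˢ⁾) e(t), where e(t) ∈ ℝ^{Nn} is the concatenation of the e_i(t).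 -/

import Mathlib

open Matrix Kronecker

theorem HasDerivAt.dotProduct_self {ι : Type*} [Fintype ι] {u : ℝ → ι → ℝ} {u' : ι → ℝ} {t : ℝ}
    (hu : HasDerivAt u u' t) :
    HasDerivAt (fun τ => u τ ⬝ᵥ u τ) (2 * (u t ⬝ᵥ u')) t := by
  have hcoord := hasDerivAt_pi.1 hu
  have hsum : HasDerivAt (fun τ => ∑ i, u τ i * u τ i) (∑ i, (u' i * u t i + u t i * u' i)) t :=
    HasDerivAt.fun_sum fun i _ => (hcoord i).mul (hcoord i)
  refine hsum.congr_deriv ?_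
  rw [dotProduct, Finset.mul_sum]
  exact Finset.sum_congr rfl fun i _ => by ring

theorem Matrix.dotProduct_kronecker_mulVec {ι κ R : Type*} [Fintype ι] [Fintype κ] [CommSemiring R]
    (A : Matrix ι ι R) (B : Matrix κ κ R) (v w : ι → κ → R) :
    (fun p : ι × κ => v p.1 p.2) ⬝ᵥ (A ⊗ₖ B) *ᵥ (fun p : ι × κ => w p.1 p.2)
      = ∑ i, ∑ j, A i j * (v i ⬝ᵥ B *ᵥ w j) := by
  simp only [dotProduct, mulVec, kroneckerMap_apply, Fintype.sum_prod_type, Finset.mul_sum]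
  refine Finset.sum_congr rfl fun i _ => ?_
  rw [Finset.sum_comm]
  refine Finset.sum_congr rfl fun j _ => Finset.sum_congr rfl fun a _ =>
    Finset.sum_congr rfl fun b _ => by ring

/-- For symmetric `A`, the quadratic form of `A ⊗ B` only depends on the symmetric part of `B`. -/
theorem Matrix.IsSymm.dotProduct_kronecker_symmPart_mulVec {ι κ : Type*} [Fintype ι] [Fintype κ]
    {A : Matrix ι ι ℝ} (hA : A.IsSymm) (B : Matrix κ κ ℝ) (v : ι → κ → ℝ) :
    (fun p : ι × κ => v p.1 p.2) ⬝ᵥ (A ⊗ₖ ((1 / 2 : ℝ) • (B + Bᵀ))) *ᵥ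
        (fun p : ι × κ => v p.1 p.2)
      = ∑ i, ∑ j, A i j * (v i ⬝ᵥ B *ᵥ v j) := by
  have htranspose : ∑ i, ∑ j, A i j * (v i ⬝ᵥ Bᵀ *ᵥ v j) =
      ∑ i, ∑ j, A i j * (v i ⬝ᵥ B *ᵥ v j) := by
    rw [Finset.sum_comm]
    refine Finset.sum_congr rfl fun i _ => Finset.sum_congr rfl fun j _ => ?_
    rw [hA.apply, mulVec_transpose, dotProduct_comm, ← dotProduct_mulVec]
  rw [dotProduct_kronecker_mulVec]
  simp only [smul_mulVec, add_mulVec, dotProduct_smul, dotProduct_add, smul_eq_mul, mul_add,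
    mul_left_comm _ (1 / 2 : ℝ), Finset.sum_add_distrib, ← Finset.mul_sum, htranspose]
  ring

/-- Lyapunov derivative estimate for the decentralized adaptive compensation scheme:
with `e_i = x_i − s`, `γ̃_i = γ_i − γ̂_i`, and
`V = (1/2)Σᵢ‖eᵢ‖² + Σᵢ (1/(2kᵢ))‖γ̃ᵢ‖²`, along the closed-loop dynamics
`V̇(t) ≤ e(t)ᵀ (I_N ⊗ F − (L + Z) ⊗ H⁽ˢ⁾) e(t)`. -/
theorem stmt_10 {N n m : ℕ}
    (L : Matrix (Fin N) (Fin N) ℝ) (hLsymm : L.IsSymm)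
    (hrow : ∀ i, ∑ j, L i j = 0)
    (z : Fin N → ℝ) (hz : ∀ i, 0 < z i)
    (H : Matrix (Fin n) (Fin n) ℝ)
    (f : (Fin n → ℝ) → (Fin n → ℝ))
    (F : Matrix (Fin n) (Fin n) ℝ) (hF : F.PosSemidef)
    (hquad : ∀ x y : Fin n → ℝ, (x - y) ⬝ᵥ (f x - f y) ≤ (x - y) ⬝ᵥ F *ᵥ (x - y))
    (G : (Fin n → ℝ) → Matrix (Fin n) (Fin m) ℝ)
    (γ : Fin N → (Fin m → ℝ)) (k : Fin N → ℝ) (hk : ∀ i, 0 < k i)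
    -- the reference trajectory
    (s : ℝ → (Fin n → ℝ)) (hs : ∀ t, HasDerivAt s (f (s t)) t)
    -- the closed-loop trajectories and mismatch estimates
    (x : Fin N → ℝ → (Fin n → ℝ)) (γhat : Fin N → ℝ → (Fin m → ℝ))
    (hodex : ∀ (i : Fin N) (t : ℝ), HasDerivAt (x i)
      (f (x i t) + (G (x i t)) *ᵥ γ i - ∑ j, L i j • (H *ᵥ x j t)
        - z i • (H *ᵥ (x i t - s t)) - (G (x i t)) *ᵥ γhat i t) t)
    (hodeγ : ∀ (i : Fin N) (t : ℝ), HasDerivAt (γhat i)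
      (k i • ((G (x i t))ᵀ *ᵥ (x i t - s t))) t)
    -- errors and Lyapunov function
    (e : Fin N → ℝ → (Fin n → ℝ)) (he : ∀ i t, e i t = x i t - s t)
    (γtil : Fin N → ℝ → (Fin m → ℝ)) (hγtil : ∀ i t, γtil i t = γ i - γhat i t)
    (V : ℝ → ℝ)
    (hV : ∀ t, V t = (1 / 2 : ℝ) * ∑ i, (e i t) ⬝ᵥ (e i t)
      + ∑ i, (1 / (2 * k i)) * ((γtil i t) ⬝ᵥ (γtil i t))) :
    ∀ t : ℝ, deriv V t ≤
      (fun p : Fin N × Fin n => e p.1 t p.2) ⬝ᵥ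
        ((1 : Matrix (Fin N) (Fin N) ℝ) ⊗ₖ F
          - (L + Matrix.diagonal z) ⊗ₖ ((1 / 2 : ℝ) • (H + Hᵀ))) *ᵥ
        (fun p : Fin N × Fin n => e p.1 t p.2) := by
  intro t
  set d : Fin N → Fin n → ℝ := fun i =>
    f (x i t) + G (x i t) *ᵥ γ i - ∑ j, L i j • (H *ᵥ x j t)
      - z i • (H *ᵥ (x i t - s t)) - G (x i t) *ᵥ γhat i t - f (s t) with hd
  have hderiv_e : ∀ i, HasDerivAt (e i) (d i) t := fun i => by
    rw [funext (he i)]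
    exact (hodex i t).sub (hs t)
  have hderiv_γtil : ∀ i, HasDerivAt (γtil i) (-(k i • ((G (x i t))ᵀ *ᵥ e i t))) t := fun i => by
    rw [funext (hγtil i), he]
    exact (hodeγ i t).const_sub (γ i)
  have hderiv_V : HasDerivAt V ((1 / 2 : ℝ) * ∑ i, 2 * (e i t ⬝ᵥ d i)
      + ∑ i, (1 / (2 * k i)) * (2 * (γtil i t ⬝ᵥ -(k i • ((G (x i t))ᵀ *ᵥ e i t))))) t := by
    rw [funext hV]
    exact ((HasDerivAt.fun_sum fun i _ => (hderiv_e i).dotProduct_self).const_mul _).add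
      (HasDerivAt.fun_sum fun i _ => (hderiv_γtil i).dotProduct_self.const_mul _)
  -- zero row sums turn the coupling of the states into a coupling of the errors
  have hcoupling : ∀ i, ∑ j, L i j • (H *ᵥ x j t) = ∑ j, L i j • (H *ᵥ e j t) := fun i => by
    simp only [he, mulVec_sub, smul_sub, Finset.sum_sub_distrib, ← Finset.sum_smul, hrow, zero_smul,
      sub_zero]
  have hd_eq : ∀ i, d i = (f (x i t) - f (s t)) + G (x i t) *ᵥ γtil i t
      - ∑ j, (L + diagonal z) i j • (H *ᵥ e j t) := fun i => by
    have hsplit : ∑ j, (L + diagonal z) i j • (H *ᵥ e j t)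
        = ∑ j, L i j • (H *ᵥ e j t) + z i • (H *ᵥ e i t) := by
      simp [add_smul, Finset.sum_add_distrib, diagonal_apply, ite_smul]
    rw [hsplit, ← hcoupling, hγtil, he, mulVec_sub]
    simp only [hd]
    abel
  have hadapt : ∀ i, (1 / (2 * k i)) * (2 * (γtil i t ⬝ᵥ -(k i • ((G (x i t))ᵀ *ᵥ e i t))))
      = -(e i t ⬝ᵥ G (x i t) *ᵥ γtil i t) := fun i => by
    have hki := (hk i).ne'
    rw [dotProduct_neg, dotProduct_smul, mulVec_transpose, dotProduct_comm, ← dotProduct_mulVec,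
      smul_eq_mul]
    field_simp
  have hone : (fun p : Fin N × Fin n => e p.1 t p.2) ⬝ᵥ
      ((1 : Matrix (Fin N) (Fin N) ℝ) ⊗ₖ F) *ᵥ (fun p : Fin N × Fin n => e p.1 t p.2)
      = ∑ i, e i t ⬝ᵥ F *ᵥ e i t := by
    rw [dotProduct_kronecker_mulVec _ _ (fun i => e i t) (fun i => e i t)]
    simp [one_apply]
  have hsymm : (L + diagonal z).IsSymm := hLsymm.add (isSymm_diagonal z)
  rw [hderiv_V.deriv, sub_mulVec, dotProduct_sub, hone,
    hsymm.dotProduct_kronecker_symmPart_mulVec H (fun i => e i t), ← Finset.mul_sum, ← mul_assoc,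
    one_div_mul_cancel two_ne_zero, one_mul, ← Finset.sum_add_distrib, ← Finset.sum_sub_distrib]
  refine Finset.sum_le_sum fun i _ => ?_
  have hquad_i := hquad (x i t) (s t)
  rw [← he] at hquad_i
  rw [hadapt, hd_eq, dotProduct_sub, dotProduct_add, dotProduct_sum]
  simp only [dotProduct_smul, smul_eq_mul]
  linarith
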